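/- Let n ≥ 2 be an odd integer, d ≥ 1 with gcd(n, d) = 1, r an integer, and a = ⟨-r/d⟩_n the unique integer in {0,…,n-1} with da + r ≡ 0 (mod n). Let f_0(q), …, f_{n-1}(q) ∈ ℤ[q] and define f̂_k(q) = Σ_{j=0}^{k} (-1)^j q^{binom(j+1,2)} qbinom(k,j) f_j(q). Then q^{d·binom(a+1,2) + (ad+r)(n-1-2a)/2} Σ_{k=0}^{n-1} ((q^r;q^d)_k (q^{d-r};q^d)_k / (q^d;q^d)_k²) q^{dk} f_k(q^d) ≡ (-1)^a Σ_{k=0}^{n-1} ((q^r;q^d)_k (q^{d-r};q^d)_k / (q^d;q^d)_k²) q^{dk} f̂_k(q^d) (mod Φ_n(q)²), meaning the difference, after clearing denominators coprime to Φ_n, is divisible by Φ_n(q)² in ℤ[q, q^{1/2}] (all q-exponents involved can be shown to be integers since n is odd). -/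

import Mathlib

open Polynomial Finset

/-- The variable `q` as a rational function over `ℚ`. -/
noncomputable def qv : RatFunc ℚ := RatFunc.X

/-- The q-Pochhammer symbol `(x; t)_k = (1-x)(1-xt)⋯(1-xt^{k-1})`. -/
noncomputable def qPochAt (x t : RatFunc ℚ) (k : ℕ) : RatFunc ℚ :=
  ∏ i ∈ Finset.range k, (1 - x * t ^ i)

/-- The Gaussian binomial coefficient `[α choose k]_t = (t^{α-k+1}; t)_k / (t; t)_k`
with integer upper argument. -/
noncomputable def qbinomAt (t : RatFunc ℚ) (α : ℤ) (k : ℕ) : RatFunc ℚ :=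
  (∏ i ∈ Finset.range k, (1 - t ^ (α - k + 1 + i))) /
    (∏ i ∈ Finset.range k, (1 - t ^ (i + 1)))

/-- The Gaussian binomial coefficient in the variable `q`. -/
noncomputable def qbinom (α : ℤ) (k : ℕ) : RatFunc ℚ := qbinomAt qv α k

/-- The image of an integer polynomial in `RatFunc ℚ`. -/
noncomputable def toF (g : Polynomial ℤ) : RatFunc ℚ :=
  Polynomial.aeval (RatFunc.X : RatFunc ℚ) g

/-- `A ≡ B (mod Φ_n(q)^m)` in the localization of `ℤ[q]` at polynomials coprime
to `Φ_n`: there are `f g : ℤ[q]` with `Φ_n ∤ g` and `(A - B) * g = Φ_n^m * f`. -/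
def modCong (n m : ℕ) (A B : RatFunc ℚ) : Prop :=
  ∃ f g : Polynomial ℤ, ¬ (Polynomial.cyclotomic n ℤ ∣ g) ∧
    (A - B) * toF g = toF ((Polynomial.cyclotomic n ℤ) ^ m * f)

/-- The q-integer `[m]_q = (1-q^m)/(1-q)`. -/
noncomputable def qint (m : ℤ) : RatFunc ℚ := (1 - qv ^ m) / (1 - qv)

/-- The q-dual in base `t`:
`f̂_k(t) = Σ_{j=0}^k (-1)^j t^{binom(j+1,2)} [k choose j]_t f_j(t)`,
with each `f_j` evaluated at `t`. -/
noncomputable def qdualAt (t : RatFunc ℚ) (f : ℕ → Polynomial ℤ) (k : ℕ) : RatFunc ℚ :=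
  ∑ j ∈ Finset.range (k + 1),
    (-1 : RatFunc ℚ) ^ j * t ^ (j * (j + 1) / 2) * qbinomAt t (k : ℤ) j *
      Polynomial.aeval t (f j)

section GenericField

variable {K : Type*} [Field K]

/-- The q-Pochhammer symbol `(x; t)_k` over an arbitrary field. -/
def poch (x t : K) (k : ℕ) : K := ∏ i ∈ Finset.range k, (1 - x * t ^ i)

/-- The Gaussian binomial coefficient in base `t` over an arbitrary field. -/
def gauss (t : K) (α : ℤ) (k : ℕ) : K :=
  (∏ i ∈ Finset.range k, (1 - t ^ (α - k + 1 + i))) /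
    (∏ i ∈ Finset.range k, (1 - t ^ (i + 1)))

/-- The weight `(x; t)_k (t/x; t)_k / (t; t)_k²`. -/
def weight (x t : K) (k : ℕ) : K := poch x t k * poch (t / x) t k / poch t t k ^ 2

/-- The q-dual in base `t` of a sequence of field elements. -/
def dualSeq (t : K) (g : ℕ → K) (k : ℕ) : K :=
  ∑ j ∈ Finset.range (k + 1), (-1 : K) ^ j * t ^ (j * (j + 1) / 2) * gauss t (k : ℤ) j * g j

lemma poch_zero (x t : K) : poch x t 0 = 1 := by simp [poch]

lemma poch_succ (x t : K) (k : ℕ) : poch x t (k + 1) = poch x t k * (1 - x * t ^ k) := by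
  simp [poch, prod_range_succ]

lemma poch_succ' (x t : K) (k : ℕ) : poch x t (k + 1) = (1 - x) * poch (x * t) t k := by
  simp only [poch, prod_range_succ']
  rw [mul_comm]
  congr 1
  · simp
  · exact prod_congr rfl fun i _ => by ring

lemma poch_add (x t : K) (j m : ℕ) :
    poch x t (j + m) = poch x t j * poch (x * t ^ j) t m := by
  simp only [poch, prod_range_add]
  congr 1
  exact prod_congr rfl fun i _ => by ring

lemma poch_ne_zero {x t : K} (h : ∀ i, 1 - x * t ^ i ≠ 0) (k : ℕ) : poch x t k ≠ 0 :=
  prod_ne_zero_iff.2 fun i _ => h i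

lemma poch_inv_pow_eq_zero {t : K} (ht : t ≠ 0) {b k : ℕ} (h : b < k) :
    poch (t ^ b)⁻¹ t k = 0 :=
  prod_eq_zero (mem_range.2 h) (by field_simp; simp)

/-- The q-Chu–Vandermonde summation. -/
lemma qChuVandermonde {t : K} (ht : t ≠ 0) (hroot : ∀ i : ℕ, t ^ (i + 1) ≠ 1) (N : ℕ) :
    ∀ (M : ℕ) (B C : K), N < M → (∀ i : ℕ, 1 - C * t ^ i ≠ 0) →
      ∑ m ∈ range M, poch (t ^ N)⁻¹ t m * poch B t m / (poch t t m * poch C t m) * t ^ m =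
        (∏ i ∈ range N, (B - C * t ^ i)) / poch C t N := by
  induction N with
  | zero =>
    intro M B C hM hC
    rw [sum_eq_single_of_mem 0 (mem_range.2 hM)]
    · simp [poch_zero]
    · intro m _ hm
      rw [poch_inv_pow_eq_zero ht (Nat.pos_of_ne_zero hm)]
      simp
  | succ N ih =>
    intro M B C hM hC
    obtain ⟨M, rfl⟩ : ∃ M', M = M' + 1 := ⟨M - 1, by omega⟩
    have hC' : ∀ i : ℕ, 1 - C * t * t ^ i ≠ 0 := fun i => by
      have := hC (i + 1)
      rwa [pow_succ', ← mul_assoc] at this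
    have hC0 : 1 - C ≠ 0 := by simpa using hC 0
    have htt : ∀ i : ℕ, 1 - t * t ^ i ≠ 0 := fun i => by
      rw [← pow_succ', sub_ne_zero]
      exact (hroot i).symm
    have hterm : ∀ m : ℕ,
        poch (t ^ (N + 1))⁻¹ t (m + 1) * poch B t (m + 1) /
            (poch t t (m + 1) * poch C t (m + 1)) * t ^ (m + 1) =
          poch (t ^ N)⁻¹ t (m + 1) * poch B t (m + 1) /
            (poch t t (m + 1) * poch C t (m + 1)) * t ^ (m + 1) -
          (t ^ N)⁻¹ * (1 - B) / (1 - C) *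
            (poch (t ^ N)⁻¹ t m * poch (B * t) t m / (poch t t m * poch (C * t) t m) * t ^ m) := by
      intro m
      have h1 : (t ^ (N + 1))⁻¹ * t = (t ^ N)⁻¹ := by rw [pow_succ]; field_simp
      rw [poch_succ' (t ^ (N + 1))⁻¹, h1, poch_succ (t ^ N)⁻¹, poch_succ' B, poch_succ t,
        poch_succ' C]
      have e1 := poch_ne_zero htt m
      have e2 := poch_ne_zero hC' m
      have e3 := htt m
      generalize poch (t ^ N)⁻¹ t m = p1
      generalize poch (B * t) t m = p2
      generalize poch t t m = p3 at *
      generalize poch (C * t) t m = p4 at *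
      field_simp
      ring
    have key : ∑ m ∈ range (M + 1),
        poch (t ^ (N + 1))⁻¹ t m * poch B t m / (poch t t m * poch C t m) * t ^ m =
        ∑ m ∈ range (M + 1), poch (t ^ N)⁻¹ t m * poch B t m / (poch t t m * poch C t m) * t ^ m -
        (t ^ N)⁻¹ * (1 - B) / (1 - C) * ∑ m ∈ range M,
          poch (t ^ N)⁻¹ t m * poch (B * t) t m / (poch t t m * poch (C * t) t m) * t ^ m := by
      rw [sum_range_succ', sum_range_succ' _ M, sum_congr rfl fun m _ => hterm m,
        sum_sub_distrib, mul_sum]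
      simp only [poch_zero]
      ring
    have hprod : ∏ i ∈ range N, (B * t - C * t * t ^ i) =
        t ^ N * ∏ i ∈ range N, (B - C * t ^ i) := by
      calc _ = ∏ i ∈ range N, (t * (B - C * t ^ i)) := prod_congr rfl fun i _ => by ring
        _ = _ := by rw [prod_mul_distrib]; simp
    rw [key, ih _ _ _ (by omega) hC, ih _ _ _ (by omega) hC', hprod, prod_range_succ]
    have e1 := poch_ne_zero hC N
    have e3 := hC N
    have e4 : poch C t N * (1 - C * t ^ N) = (1 - C) * poch (C * t) t N := by
      rw [← poch_succ, poch_succ']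
    have e5 : poch (C * t) t N = poch C t N * (1 - C * t ^ N) / (1 - C) := by
      rw [e4]; field_simp
    rw [poch_succ, e5]
    generalize ∏ i ∈ range N, (B - C * t ^ i) = p
    obtain ⟨v, hv⟩ : ∃ v, v = 1 - C * t ^ N := ⟨_, rfl⟩
    rw [show B - C * t ^ N = B - 1 + v by rw [hv]; ring]
    rw [← hv] at e3 ⊢
    field_simp
    ring

lemma gauss_add {t : K} (hroot : ∀ i : ℕ, t ^ (i + 1) ≠ 1) (j m : ℕ) :
    gauss t ((j + m : ℕ) : ℤ) j = poch t t (j + m) / (poch t t j * poch t t m) := by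
  have htt : ∀ i : ℕ, 1 - t * t ^ i ≠ 0 := fun i => by
    rw [← pow_succ', sub_ne_zero]
    exact (hroot i).symm
  have h1 : ∏ i ∈ Finset.range j, (1 - t ^ (((j + m : ℕ) : ℤ) - j + 1 + i)) =
      poch (t * t ^ m) t j := by
    refine prod_congr rfl fun i _ => ?_
    rw [← pow_succ', ← pow_add, ← zpow_natCast]
    congr 2
    push_cast
    ring
  have h2 : ∏ i ∈ Finset.range j, (1 - t ^ (i + 1)) = poch t t j :=
    prod_congr rfl fun i _ => by rw [pow_succ']
  have e1 := poch_ne_zero htt j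
  have e2 := poch_ne_zero htt m
  rw [gauss, h1, h2, add_comm j m, poch_add]
  field_simp

lemma prod_pow_sub_pow {t : K} (j N : ℕ) :
    ∏ i ∈ range N, (t ^ (1 + (j + N) + j) - t ^ (j + 1) * t ^ i) =
      (-1) ^ N * t ^ (N * (j + 1) + ∑ i ∈ range N, i) * poch (t ^ (j + 1)) t N := by
  have h1 : poch (t ^ (j + 1)) t N = ∏ i ∈ range N, (1 - t ^ (j + 1) * t ^ (N - 1 - i)) :=
    (prod_range_reflect (fun i => 1 - t ^ (j + 1) * t ^ i) N).symm
  rw [h1, pow_add t (N * (j + 1)), ← prod_pow_eq_pow_sum, pow_mul']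
  have h2 : ∀ c : K, c ^ N = ∏ i ∈ range N, c := fun c => by simp
  rw [h2, h2, ← prod_mul_distrib, ← prod_mul_distrib, ← prod_mul_distrib]
  refine prod_congr rfl fun i hi => ?_
  obtain ⟨e, rfl⟩ : ∃ e, N = i + 1 + e := ⟨N - (i + 1), by have := mem_range.1 hi; omega⟩
  rw [show i + 1 + e - 1 - i = e by omega]
  ring

lemma triangle_add (j N : ℕ) :
    j * (j + 1) / 2 + (N * (j + 1) + ∑ i ∈ range N, i) = (j + N) * (j + N + 1) / 2 := by
  have e : ∀ k, k * (k + 1) / 2 = ∑ i ∈ range (k + 1), i := fun k => by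
    rw [Finset.sum_range_id, mul_comm]; rfl
  rw [e, e]
  induction N with
  | zero => simp
  | succ N ih =>
    rw [← add_assoc j N 1, sum_range_succ _ (j + N + 1), ← ih, sum_range_succ _ N]
    ring

lemma sum_weight_gauss {t : K} (ht : t ≠ 0) (hroot : ∀ i : ℕ, t ^ (i + 1) ≠ 1) {b n : ℕ}
    (hb : b < n) (j : ℕ) :
    (-1) ^ b * ((-1) ^ j * t ^ (j * (j + 1) / 2) *
      ∑ k ∈ Ico j n, weight (t ^ b)⁻¹ t k * t ^ k * gauss t (k : ℤ) j) =
        t ^ (b * (b + 1) / 2) * (weight (t ^ b)⁻¹ t j * t ^ j) := by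
  have htt : ∀ i : ℕ, 1 - t * t ^ i ≠ 0 := fun i => by
    rw [← pow_succ', sub_ne_zero]
    exact (hroot i).symm
  rcases lt_or_ge b j with hj | hj
  · have hw : ∀ k, j ≤ k → weight (t ^ b)⁻¹ t k = 0 := fun k hk => by
      simp [weight, poch_inv_pow_eq_zero ht (hj.trans_le hk)]
    rw [hw j le_rfl, sum_eq_zero fun k hk => by rw [hw k (mem_Ico.1 hk).1]; simp]
    simp
  · obtain ⟨N, rfl⟩ : ∃ N, b = j + N := ⟨b - j, by omega⟩
    have hC : ∀ i : ℕ, 1 - t ^ (j + 1) * t ^ i ≠ 0 := fun i => by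
      rw [← pow_add, sub_ne_zero, show j + 1 + i = (j + i) + 1 by ring]
      exact (hroot _).symm
    have hterm : ∀ m, weight (t ^ (j + N))⁻¹ t (j + m) * t ^ (j + m) *
        gauss t ((j + m : ℕ) : ℤ) j = weight (t ^ (j + N))⁻¹ t j * t ^ j *
          (poch (t ^ N)⁻¹ t m * poch (t ^ (1 + (j + N) + j)) t m /
            (poch t t m * poch (t ^ (j + 1)) t m) * t ^ m) := by
      intro m
      have h1 : (t ^ (j + N))⁻¹ * t ^ j = (t ^ N)⁻¹ := by rw [pow_add]; field_simp
      have h2 : t / (t ^ (j + N))⁻¹ * t ^ j = t ^ (1 + (j + N) + j) := by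
        rw [div_inv_eq_mul]; ring
      have h3 : t * t ^ j = t ^ (j + 1) := by ring
      rw [gauss_add hroot, weight, weight, poch_add (t ^ (j + N))⁻¹, poch_add (t / _), poch_add t,
        h1, h2, h3]
      have e1 := poch_ne_zero htt m
      have e2 := poch_ne_zero htt j
      have e3 := poch_ne_zero hC m
      field_simp
      ring
    rw [sum_Ico_eq_sum_range, sum_congr rfl fun m _ => hterm m, ← mul_sum,
      qChuVandermonde ht hroot N _ _ _ (by omega) hC, prod_pow_sub_pow,
      mul_div_cancel_right₀ _ (poch_ne_zero hC N), ← triangle_add j N, pow_add t (_ / 2)]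
    have hs : ((-1 : K) ^ (j + N)) * (-1) ^ j * (-1) ^ N = 1 := by
      rw [mul_assoc, ← pow_add, ← mul_pow]; simp
    linear_combination (t ^ (j * (j + 1) / 2) * t ^ (N * (j + 1) + ∑ i ∈ range N, i) *
      (weight (t ^ (j + N))⁻¹ t j * t ^ j)) * hs

/-- The symmetric identity at the terminating parameter `x = t⁻ᵇ`. -/
lemma sum_weight_dualSeq {t : K} (ht : t ≠ 0) (hroot : ∀ i : ℕ, t ^ (i + 1) ≠ 1) {b n : ℕ}
    (hb : b < n) (g : ℕ → K) :
    (-1) ^ b * ∑ k ∈ range n, weight (t ^ b)⁻¹ t k * t ^ k * dualSeq t g k =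
      t ^ (b * (b + 1) / 2) * ∑ k ∈ range n, weight (t ^ b)⁻¹ t k * t ^ k * g k := by
  have h1 : ∑ k ∈ range n, weight (t ^ b)⁻¹ t k * t ^ k * dualSeq t g k =
      ∑ j ∈ range n, ∑ k ∈ Ico j n, weight (t ^ b)⁻¹ t k * t ^ k *
        ((-1 : K) ^ j * t ^ (j * (j + 1) / 2) * gauss t (k : ℤ) j * g j) := by
    simp only [dualSeq, mul_sum]
    refine sum_comm' fun k j => ?_
    simp only [mem_range, mem_Ico]
    omega
  rw [h1, mul_sum, mul_sum]
  refine sum_congr rfl fun j _ => ?_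
  have := sum_weight_gauss ht hroot hb j
  rw [← mul_assoc, ← this, mul_assoc ((-1 : K) ^ b)]
  congr 1
  rw [mul_sum, sum_mul]
  exact sum_congr rfl fun k _ => by ring

lemma weight_symm {x t : K} (ht : t ≠ 0) (k : ℕ) : weight (t / x) t k = weight x t k := by
  rw [weight, weight, div_div_cancel₀ ht, mul_comm (poch _ _ _)]

/-- `D` agrees on nonzero arguments with a Laurent polynomial with coefficients in `R`. -/
def IsLaurent (R : Subring K) (D : K → K) : Prop :=
  ∃ (P : R[X]) (N : ℕ), ∀ y : K, y ≠ 0 → y ^ N * D y = aeval y P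

namespace IsLaurent

variable {R : Subring K} {D E : K → K}

lemma const {c : K} (hc : c ∈ R) : IsLaurent R fun _ => c :=
  ⟨C ⟨c, hc⟩, 0, fun y _ => by simp; rfl⟩

lemma id : IsLaurent R fun y => y := ⟨X, 0, fun y _ => by simp⟩

lemma inv : IsLaurent R fun y => y⁻¹ := ⟨1, 1, fun y hy => by simp [hy]⟩

lemma mul (hD : IsLaurent R D) (hE : IsLaurent R E) : IsLaurent R fun y => D y * E y := by
  obtain ⟨P, N, hP⟩ := hD
  obtain ⟨Q, M, hQ⟩ := hE
  refine ⟨P * Q, N + M, fun y hy => ?_⟩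
  rw [map_mul, ← hP y hy, ← hQ y hy]
  ring

lemma add (hD : IsLaurent R D) (hE : IsLaurent R E) : IsLaurent R fun y => D y + E y := by
  obtain ⟨P, N, hP⟩ := hD
  obtain ⟨Q, M, hQ⟩ := hE
  refine ⟨X ^ M * P + X ^ N * Q, N + M, fun y hy => ?_⟩
  simp only [map_add, map_mul, map_pow, aeval_X, ← hP y hy, ← hQ y hy]
  ring

lemma sub (hD : IsLaurent R D) (hE : IsLaurent R E) : IsLaurent R fun y => D y - E y := by
  have h := hD.add ((const (R := R) (c := -1) (neg_mem (one_mem R))).mul hE)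
  simpa [sub_eq_add_neg] using h

lemma sum {ι : Type*} (s : Finset ι) {F : ι → K → K} (h : ∀ i ∈ s, IsLaurent R (F i)) :
    IsLaurent R fun y => ∑ i ∈ s, F i y := by
  classical
  induction s using Finset.induction_on with
  | empty => simpa using const (zero_mem R)
  | insert i s hi ih =>
    simp only [sum_insert hi]
    exact (h i (by simp)).add (ih fun j hj => h j (by simp [hj]))

lemma prod {ι : Type*} (s : Finset ι) {F : ι → K → K} (h : ∀ i ∈ s, IsLaurent R (F i)) :
    IsLaurent R fun y => ∏ i ∈ s, F i y := by
  classical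
  induction s using Finset.induction_on with
  | empty => simpa using const (one_mem R)
  | insert i s hi ih =>
    simp only [prod_insert hi]
    exact (h i (by simp)).mul (ih fun j hj => h j (by simp [hj]))

lemma pow (hD : IsLaurent R D) (k : ℕ) : IsLaurent R fun y => D y ^ k := by
  simpa using prod (range k) fun _ _ => hD

lemma zpow (h : ℤ) : IsLaurent R fun y => y ^ h := by
  cases h with
  | ofNat k => simpa using id.pow k
  | negSucc k => simpa [zpow_negSucc] using inv.pow (k + 1)

lemma poch {t : K} (ht : t ∈ R) (hD : IsLaurent R D) (k : ℕ) :
    IsLaurent R fun y => poch (D y) t k :=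
  prod _ fun i _ => (const (one_mem R)).sub (hD.mul (const (pow_mem ht i)))

lemma weight {t c : K} (ht : t ∈ R) (hc : c ∈ R) (hc' : c⁻¹ ∈ R) {k : ℕ}
    (hk : (_root_.poch t t k)⁻¹ ∈ R) : IsLaurent R fun y => weight (c * y) t k := by
  have h := (((const hc).mul id).poch ht k).mul
    ((((const (mul_mem ht hc')).mul inv).poch ht k).mul (const (pow_mem hk 2)))
  convert h using 2 with y
  rw [_root_.weight, div_eq_mul_inv t, mul_inv, ← mul_assoc t, inv_pow]
  ring

/-- A Laurent polynomial over `R` vanishing at two points is divisible by the linear factors. -/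
lemma exists_eq_mul (hD : IsLaurent R D) {u v y : K} (hu : u ∈ R) (hv : v ∈ R) (hy : y ∈ R)
    (hy' : y⁻¹ ∈ R) (hu0 : u ≠ 0) (hv0 : v ≠ 0) (hy0 : y ≠ 0) (huv : u ≠ v)
    (hDu : D u = 0) (hDv : D v = 0) : ∃ c ∈ R, D y = (y - u) * (y - v) * c := by
  obtain ⟨P, N, hP⟩ := hD
  have coe_eval : ∀ (Q : R[X]) (w : R), aeval (w : K) Q = ((Q.eval w : R) : K) := fun Q w =>
    aeval_algebraMap_apply_eq_algebraMap_eval w Q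
  have h1 : P.IsRoot ⟨u, hu⟩ := by
    have := hP u hu0
    rw [hDu, mul_zero, coe_eval P ⟨u, hu⟩] at this
    exact Subtype.ext this.symm
  obtain ⟨Q, rfl⟩ := dvd_iff_isRoot.2 h1
  have h2 : Q.IsRoot ⟨v, hv⟩ := by
    have := hP v hv0
    rw [hDv, mul_zero, map_mul, coe_eval Q ⟨v, hv⟩] at this
    have h3 : aeval v (X - C (⟨u, hu⟩ : R)) = v - u := by simp; rfl
    rw [h3, eq_comm, mul_eq_zero, sub_eq_zero] at this
    exact Subtype.ext (this.resolve_left huv.symm)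
  obtain ⟨S, rfl⟩ := dvd_iff_isRoot.2 h2
  refine ⟨(y⁻¹) ^ N * ((S.eval ⟨y, hy⟩ : R) : K), mul_mem (pow_mem hy' N) (SetLike.coe_mem _), ?_⟩
  have h3 := hP y hy0
  rw [map_mul, map_mul, coe_eval S ⟨y, hy⟩, show aeval y (X - C (⟨u, hu⟩ : R)) = y - u by simp; rfl,
    show aeval y (X - C (⟨v, hv⟩ : R)) = y - v by simp; rfl] at h3
  have h4 : y⁻¹ ^ N * y ^ N = 1 := by rw [← mul_pow, inv_mul_cancel₀ hy0, one_pow]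
  linear_combination y⁻¹ ^ N * h3 - D y * h4

end IsLaurent

lemma zpow_mem_of_inv_mem {R : Subring K} {t : K} (ht : t ∈ R) (ht' : t⁻¹ ∈ R) (m : ℤ) :
    t ^ m ∈ R := by
  cases m with
  | ofNat k => simpa using pow_mem ht k
  | negSucc k => simpa [zpow_negSucc] using pow_mem ht' (k + 1)

lemma inv_prod_one_sub_mem {R : Subring K} {t : K} {n : ℕ}
    (h : ∀ i, i + 1 < n → (1 - t ^ (i + 1))⁻¹ ∈ R) {k : ℕ} (hk : k < n) :
    (∏ i ∈ range k, (1 - t ^ (i + 1)))⁻¹ ∈ R := by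
  rw [← prod_inv_distrib]
  exact prod_mem fun i hi => h i (by have := mem_range.1 hi; omega)

lemma dualSeq_mem {R : Subring K} {t : K} {n : ℕ} (ht : t ∈ R) (ht' : t⁻¹ ∈ R)
    (h : ∀ i, i + 1 < n → (1 - t ^ (i + 1))⁻¹ ∈ R) {g : ℕ → K} (hg : ∀ k, g k ∈ R) {k : ℕ}
    (hk : k < n) : dualSeq t g k ∈ R := by
  refine sum_mem fun j hj => mul_mem (mul_mem (mul_mem (pow_mem (neg_mem (one_mem R)) _)
    (pow_mem ht _)) ?_) (hg j)
  rw [gauss, div_eq_mul_inv]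
  refine mul_mem (prod_mem fun i _ => sub_mem (one_mem R) (zpow_mem_of_inv_mem ht ht' _))
    (inv_prod_one_sub_mem h ?_)
  have := mem_range.1 hj
  omega

/-- The two sides of the symmetric congruence, at `x = t⁻ᵃ y`, differ by a multiple of
`(y - 1) (y - tⁿ)`. -/
lemma exists_symmetric_difference {R : Subring K} {t y : K} {n a : ℕ} (ht : t ∈ R)
    (ht' : t⁻¹ ∈ R) (ht0 : t ≠ 0) (hroot : ∀ i : ℕ, t ^ (i + 1) ≠ 1)
    (h : ∀ i, i + 1 < n → (1 - t ^ (i + 1))⁻¹ ∈ R) (hn : Odd n) (ha : a < n)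
    (hy : y ∈ R) (hy' : y⁻¹ ∈ R) (hy0 : y ≠ 0) {g : ℕ → K} (hg : ∀ k, g k ∈ R) :
    ∃ c ∈ R, t ^ (a * (a + 1) / 2) * y ^ (((n : ℤ) - 1 - 2 * a) / 2) *
        ∑ k ∈ range n, weight ((t ^ a)⁻¹ * y) t k * t ^ k * g k -
      (-1) ^ a * ∑ k ∈ range n, weight ((t ^ a)⁻¹ * y) t k * t ^ k * dualSeq t g k =
        (y - 1) * (y - t ^ n) * c := by
  have hc : (t ^ a)⁻¹ ∈ R := by rw [← inv_pow]; exact pow_mem ht' a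
  have hc' : (t ^ a)⁻¹⁻¹ ∈ R := by rw [inv_inv]; exact pow_mem ht a
  have hw : ∀ k ∈ range n, IsLaurent R fun y => weight ((t ^ a)⁻¹ * y) t k := fun k hk => by
    refine IsLaurent.weight ht hc hc' ?_
    simpa only [poch, ← pow_succ'] using inv_prod_one_sub_mem h (mem_range.1 hk)
  have htn : (1 : K) ≠ t ^ n := by
    obtain ⟨m, rfl⟩ : ∃ m, n = m + 1 := ⟨n - 1, by omega⟩
    exact (hroot m).symm
  refine IsLaurent.exists_eq_mul (D := fun y => t ^ (a * (a + 1) / 2) *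
        y ^ (((n : ℤ) - 1 - 2 * a) / 2) *
        ∑ k ∈ range n, weight ((t ^ a)⁻¹ * y) t k * t ^ k * g k -
      (-1) ^ a * ∑ k ∈ range n, weight ((t ^ a)⁻¹ * y) t k * t ^ k * dualSeq t g k)
    ?_ (one_mem R) (pow_mem ht n) hy hy' one_ne_zero (pow_ne_zero n ht0) hy0 htn ?_ ?_
  · refine IsLaurent.sub (((IsLaurent.const (pow_mem ht _)).mul (IsLaurent.zpow _)).mul
      (IsLaurent.sum _ fun k hk => ((hw k hk).mul (.const (pow_mem ht k))).mul (.const (hg k))))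
      ((IsLaurent.const (pow_mem (neg_mem (one_mem R)) a)).mul
      (IsLaurent.sum _ fun k hk => ((hw k hk).mul (.const (pow_mem ht k))).mul
        (.const (dualSeq_mem ht ht' h hg (mem_range.1 hk)))))
  · simp only [mul_one, one_zpow]
    rw [sub_eq_zero]
    exact (sum_weight_dualSeq ht0 hroot ha g).symm
  · obtain ⟨b, rfl⟩ : ∃ b, n = a + b + 1 := ⟨n - 1 - a, by omega⟩
    have hx : ∀ k, weight ((t ^ a)⁻¹ * t ^ (a + b + 1)) t k = weight (t ^ b)⁻¹ t k := fun k => by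
      rw [← weight_symm ht0 (x := (t ^ b)⁻¹)]
      congr 1
      rw [div_inv_eq_mul]
      field_simp
      ring
    have hab : Even (a + b) := by
      rcases Nat.even_or_odd (a + b) with h | h
      · exact h
      · exact absurd hn (by simpa using h.add_one)
    have hsign : (-1 : K) ^ a = (-1) ^ b := by
      have h1 : (-1 : K) ^ a * (-1) ^ b = 1 := by rw [← pow_add, hab.neg_one_pow]
      have h2 : (-1 : K) ^ b * (-1) ^ b = 1 := by rw [← pow_add, (Even.add_self b).neg_one_pow]
      linear_combination (-1 : K) ^ b * h1 - (-1) ^ a * h2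
    have hexp : t ^ (a * (a + 1) / 2) *
        (t ^ (a + b + 1)) ^ ((((a + b + 1 : ℕ) : ℤ) - 1 - 2 * a) / 2) =
          t ^ (b * (b + 1) / 2) := by
      rw [← zpow_natCast, ← zpow_natCast, ← zpow_natCast, ← zpow_mul, ← zpow_add₀ ht0]
      congr 1
      obtain ⟨m, hm⟩ := hab
      have e1 : (((a + b + 1 : ℕ) : ℤ) - 1 - 2 * a) / 2 = m - a := by omega
      have e2 : b * (b + 1) / 2 * 2 = b * (b + 1) :=
        Nat.div_mul_cancel (Nat.even_mul_succ_self b).two_dvd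
      have e3 : a * (a + 1) / 2 * 2 = a * (a + 1) :=
        Nat.div_mul_cancel (Nat.even_mul_succ_self a).two_dvd
      rw [e1]
      zify at e2 e3 hm
      have hb : (b : ℤ) = m + m - a := by linarith
      push_cast at *
      rw [hb] at e2 ⊢
      linarith
    simp only [hx]
    rw [hexp, hsign, sub_eq_zero]
    exact (sum_weight_dualSeq ht0 hroot (by omega) g).symm

end GenericField

lemma toF_mul (f g : ℤ[X]) : toF (f * g) = toF f * toF g := map_mul _ f g

lemma toF_add (f g : ℤ[X]) : toF (f + g) = toF f + toF g := map_add _ f g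

lemma toF_neg (f : ℤ[X]) : toF (-f) = -toF f := map_neg _ f

lemma toF_pow (f : ℤ[X]) (m : ℕ) : toF (f ^ m) = toF f ^ m := map_pow _ f m

lemma toF_injective : Function.Injective toF := by
  intro f g h
  have key : ∀ p : ℤ[X], toF p = algebraMap ℚ[X] (RatFunc ℚ) (p.map (Int.castRingHom ℚ)) := by
    intro p
    rw [toF, ← RatFunc.algebraMap_X, aeval_def, eval₂_eq_sum_range]
    conv_rhs => rw [← eval₂_C_X (p := p.map (Int.castRingHom ℚ)), eval₂_map, eval₂_eq_sum_range]
    simp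
  rw [key, key] at h
  exact Polynomial.map_injective _ Int.cast_injective (RatFunc.algebraMap_injective ℚ h)

/-- The localization of `ℤ[q]` at the prime ideal generated by `Φ_n`, inside `ℚ(q)`. -/
def cyclotomicLocal (n : ℕ) (hn : 0 < n) : Subring (RatFunc ℚ) where
  carrier := {z | ∃ f g : ℤ[X], ¬ cyclotomic n ℤ ∣ g ∧ z * toF g = toF f}
  mul_mem' := by
    rintro x y ⟨f, g, hg, h⟩ ⟨f', g', hg', h'⟩
    refine ⟨f * f', g * g', fun hd => ?_, ?_⟩
    · exact ((cyclotomic.irreducible hn).prime.dvd_or_dvd hd).elim hg hg'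
    · rw [toF_mul, toF_mul, ← h, ← h']
      ring
  one_mem' := ⟨1, 1, (cyclotomic.irreducible hn).prime.not_dvd_one, by simp⟩
  add_mem' := by
    rintro x y ⟨f, g, hg, h⟩ ⟨f', g', hg', h'⟩
    refine ⟨f * g' + f' * g, g * g', fun hd => ?_, ?_⟩
    · exact ((cyclotomic.irreducible hn).prime.dvd_or_dvd hd).elim hg hg'
    · rw [toF_add, toF_mul, toF_mul, toF_mul, ← h, ← h']
      ring
  zero_mem' := ⟨0, 1, (cyclotomic.irreducible hn).prime.not_dvd_one, by simp [toF]⟩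
  neg_mem' := by
    rintro x ⟨f, g, hg, h⟩
    exact ⟨-f, g, hg, by rw [toF_neg, ← h]; ring⟩

lemma aeval_root_of_cyclotomic_dvd {n : ℕ} (hn : 0 < n) {g : ℤ[X]} (h : cyclotomic n ℤ ∣ g) :
    aeval (Complex.exp (2 * Real.pi * Complex.I / n)) g = 0 := by
  have hz := Complex.isPrimitiveRoot_exp n hn.ne'
  obtain ⟨c, rfl⟩ := h
  have : aeval (Complex.exp (2 * Real.pi * Complex.I / n)) (cyclotomic n ℤ) = 0 := by
    rw [cyclotomic_eq_minpoly hz hn]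
    exact minpoly.aeval _ _
  rw [map_mul, this, zero_mul]

lemma cyclotomic_not_dvd_X {n : ℕ} (hn : 0 < n) : ¬ cyclotomic n ℤ ∣ X := fun h => by
  have := aeval_root_of_cyclotomic_dvd hn h
  rw [aeval_X] at this
  exact Complex.exp_ne_zero _ this

lemma cyclotomic_not_dvd_one_sub_X_pow {n : ℕ} (hn : 0 < n) {m : ℕ} (hm : ¬ n ∣ m) :
    ¬ cyclotomic n ℤ ∣ 1 - X ^ m := fun h => by
  have := aeval_root_of_cyclotomic_dvd hn h
  simp only [map_sub, map_one, map_pow, aeval_X] at this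
  exact hm ((Complex.isPrimitiveRoot_exp n hn.ne').pow_eq_one_iff_dvd m |>.1
    (sub_eq_zero.1 this).symm)

section Localization

variable {n : ℕ} (hn : 0 < n)

lemma toF_mem (f : ℤ[X]) : toF f ∈ cyclotomicLocal n hn :=
  ⟨f, 1, (cyclotomic.irreducible hn).prime.not_dvd_one, by simp [toF]⟩

lemma toF_inv_mem {g : ℤ[X]} (hg : ¬ cyclotomic n ℤ ∣ g) :
    (toF g)⁻¹ ∈ cyclotomicLocal n hn := by
  refine ⟨1, g, hg, ?_⟩
  have h0 : toF g ≠ 0 := fun h => hg (by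
    rw [toF_injective (h.trans (by simp [toF] : (0 : RatFunc ℚ) = toF 0))]
    exact dvd_zero _)
  rw [inv_mul_cancel₀ h0]
  simp [toF]

lemma qv_ne_zero : qv ≠ 0 := RatFunc.X_ne_zero

lemma toF_X_pow (m : ℕ) : toF (X ^ m) = qv ^ m := by simp [toF, qv]

lemma qv_pow_ne_one {m : ℕ} (hm : 0 < m) : qv ^ m ≠ 1 := by
  rw [← toF_X_pow, show (1 : RatFunc ℚ) = toF 1 by simp [toF]]
  intro h
  have := congrArg natDegree (toF_injective h)
  simp at this
  omega

lemma qv_mem : qv ∈ cyclotomicLocal n hn := by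
  simpa [toF, qv] using toF_mem hn X

lemma qv_inv_mem : qv⁻¹ ∈ cyclotomicLocal n hn := by
  have := toF_inv_mem hn (cyclotomic_not_dvd_X hn)
  rwa [← pow_one X, toF_X_pow, pow_one] at this

lemma qv_zpow_sub_one (s : ℤ) :
    ∃ c ∈ cyclotomicLocal n hn, qv ^ ((n : ℤ) * s) - 1 = toF (cyclotomic n ℤ) * c := by
  have hnat : ∀ k : ℕ,
      ∃ c ∈ cyclotomicLocal n hn, qv ^ (n * k) - 1 = toF (cyclotomic n ℤ) * c := by
    intro k
    obtain ⟨c, hc⟩ : cyclotomic n ℤ ∣ X ^ (n * k) - 1 :=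
      (cyclotomic.dvd_X_pow_sub_one n ℤ).trans (by
        simpa [pow_mul] using sub_dvd_pow_sub_pow ((X : ℤ[X]) ^ n) 1 k)
    refine ⟨toF c, toF_mem hn c, ?_⟩
    rw [← toF_mul, ← hc, ← toF_X_pow]
    simp [toF]
  obtain ⟨k, rfl | rfl⟩ := s.eq_nat_or_neg
  · obtain ⟨c, hc, h⟩ := hnat k
    exact ⟨c, hc, by exact_mod_cast h⟩
  · obtain ⟨c, hc, h⟩ := hnat k
    refine ⟨-(qv⁻¹ ^ (n * k) * c), neg_mem (mul_mem (pow_mem (qv_inv_mem hn) _) hc), ?_⟩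
    have h1 : qv ^ ((n : ℤ) * -(k : ℤ)) = qv⁻¹ ^ (n * k) := by
      rw [mul_neg, zpow_neg, inv_pow]
      norm_cast
    have h2 : qv⁻¹ ^ (n * k) * qv ^ (n * k) = 1 := by
      rw [← mul_pow, inv_mul_cancel₀ qv_ne_zero, one_pow]
    rw [h1]
    linear_combination (-qv⁻¹ ^ (n * k)) * h + h2

lemma modCong_of_sub_eq {m : ℕ} {A B c : RatFunc ℚ} (hc : c ∈ cyclotomicLocal n hn)
    (h : A - B = toF (cyclotomic n ℤ) ^ m * c) : modCong n m A B := by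
  obtain ⟨f, g, hg, hfg⟩ := hc
  refine ⟨f, g, hg, ?_⟩
  rw [h, toF_mul, ← hfg, mul_assoc, toF_pow]

end Localization

/-- Symmetric q-congruence (odd case): for odd `n ≥ 2`, `d ≥ 1` with `gcd(n,d) = 1`,
`r : ℤ`, and `a = ⟨-r/d⟩_n` (i.e. `0 ≤ a < n` with `da + r ≡ 0 (mod n)`):
`q^{d·binom(a+1,2) + (ad+r)(n-1-2a)/2} Σ_{k<n} w_k q^{dk} f_k(q^d)
  ≡ (-1)^a Σ_{k<n} w_k q^{dk} f̂_k(q^d) (mod Φ_n(q)²)`,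
where `w_k = (q^r;q^d)_k (q^{d-r};q^d)_k / (q^d;q^d)_k²`. -/
theorem stmt13 (n d : ℕ) (hn : 2 ≤ n) (hodd : Odd n) (hd : 1 ≤ d)
    (hcop : Nat.Coprime n d) (r : ℤ) (a : ℕ) (ha : a < n)
    (har : ((d : ℤ) * a + r) % (n : ℤ) = 0) (f : ℕ → Polynomial ℤ) :
    modCong n 2
      (qv ^ ((d : ℤ) * ((a : ℤ) * ((a : ℤ) + 1) / 2) +
            ((a : ℤ) * d + r) * (((n : ℤ) - 1 - 2 * a) / 2)) *
        ∑ k ∈ Finset.range n,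
          (qPochAt (qv ^ r) (qv ^ d) k * qPochAt (qv ^ ((d : ℤ) - r)) (qv ^ d) k /
              (qPochAt (qv ^ d) (qv ^ d) k) ^ 2) *
            qv ^ (d * k) * Polynomial.aeval ((qv : RatFunc ℚ) ^ d) (f k))
      ((-1 : RatFunc ℚ) ^ a *
        ∑ k ∈ Finset.range n,
          (qPochAt (qv ^ r) (qv ^ d) k * qPochAt (qv ^ ((d : ℤ) - r)) (qv ^ d) k /
              (qPochAt (qv ^ d) (qv ^ d) k) ^ 2) *
            qv ^ (d * k) * qdualAt (qv ^ d) f k) := by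
  have hn0 : 0 < n := by omega
  obtain ⟨s, hs⟩ := Int.dvd_of_emod_eq_zero har
  have hq := qv_ne_zero
  have ht : qv ^ d ∈ cyclotomicLocal n hn0 := pow_mem (qv_mem hn0) d
  have ht' : (qv ^ d)⁻¹ ∈ cyclotomicLocal n hn0 := by
    rw [← inv_pow]
    exact pow_mem (qv_inv_mem hn0) d
  have hinv : ∀ i, i + 1 < n → (1 - (qv ^ d) ^ (i + 1))⁻¹ ∈ cyclotomicLocal n hn0 := by
    intro i hi
    have hnd : ¬ n ∣ d * (i + 1) := fun h =>
      absurd (Nat.le_of_dvd (by omega) (hcop.dvd_of_dvd_mul_left h)) (by omega)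
    have := toF_inv_mem hn0 (cyclotomic_not_dvd_one_sub_X_pow hn0 hnd)
    rwa [show toF (1 - X ^ (d * (i + 1))) = 1 - (qv ^ d) ^ (i + 1) by
      rw [← pow_mul, ← toF_X_pow]; simp [toF]] at this
  have hg : ∀ k, aeval (qv ^ d) (f k) ∈ cyclotomicLocal n hn0 := fun k => by
    have := toF_mem hn0 ((f k).comp (X ^ d))
    rwa [toF, aeval_comp, ← toF, toF_X_pow] at this
  have hy := zpow_mem_of_inv_mem (qv_mem hn0) (qv_inv_mem hn0) ((n : ℤ) * s)
  have hy' : (qv ^ ((n : ℤ) * s))⁻¹ ∈ cyclotomicLocal n hn0 := by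
    rw [← zpow_neg]
    exact zpow_mem_of_inv_mem (qv_mem hn0) (qv_inv_mem hn0) _
  obtain ⟨c, hc, hmain⟩ := exists_symmetric_difference ht ht' (pow_ne_zero d hq)
    (fun i => by rw [← pow_mul]; exact qv_pow_ne_one (by positivity)) hinv hodd ha hy hy'
    (zpow_ne_zero _ hq) hg
  obtain ⟨c₁, hc₁, h₁⟩ := qv_zpow_sub_one hn0 s
  obtain ⟨c₂, hc₂, h₂⟩ := qv_zpow_sub_one hn0 (d : ℤ)
  have hx : ((qv ^ d) ^ a)⁻¹ * qv ^ ((n : ℤ) * s) = qv ^ r := by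
    rw [← hs, ← pow_mul, zpow_add₀ hq, ← Nat.cast_mul, zpow_natCast]
    field_simp
  have hx' : qv ^ d / qv ^ r = qv ^ ((d : ℤ) - r) := by
    rw [zpow_sub₀ hq, zpow_natCast]
  have hexp : qv ^ ((d : ℤ) * ((a : ℤ) * ((a : ℤ) + 1) / 2) +
      ((a : ℤ) * d + r) * (((n : ℤ) - 1 - 2 * a) / 2)) =
      (qv ^ d) ^ (a * (a + 1) / 2) * (qv ^ ((n : ℤ) * s)) ^ (((n : ℤ) - 1 - 2 * a) / 2) := by
    rw [zpow_add₀ hq, mul_comm (a : ℤ) (d : ℤ), hs, zpow_mul qv ((n : ℤ) * s), ← pow_mul,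
      ← zpow_natCast qv (d * _)]
    push_cast
    rfl
  refine modCong_of_sub_eq hn0 (mul_mem (mul_mem hc₁ (sub_mem hc₁ hc₂)) hc) ?_
  rw [hexp]
  simp only [hx, weight, hx'] at hmain
  simp only [← pow_mul qv d] at hmain
  have hfac : (qv ^ ((n : ℤ) * s) - 1) * (qv ^ ((n : ℤ) * s) - qv ^ (d * n)) =
      toF (cyclotomic n ℤ) ^ 2 * (c₁ * (c₁ - c₂)) := by
    have h₃ : qv ^ (d * n) - 1 = toF (cyclotomic n ℤ) * c₂ := by
      rw [← h₂, mul_comm d n]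
      norm_cast
    rw [show qv ^ ((n : ℤ) * s) - qv ^ (d * n) =
      (qv ^ ((n : ℤ) * s) - 1) - (qv ^ (d * n) - 1) by ring, h₁, h₃]
    ring
  rw [hfac] at hmain
  rw [← mul_assoc, ← hmain, ← pow_mul qv d]
  rfl
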